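/- The discrete Fourier transform equals a scalar multiple of the Weil operator at the Weyl element: F = i^((p−1)/2) · ρ(w), where w = [[0,1],[−1,0]] ∈ SL(2, ZMod p) (note det(w − I) = 2 ≠ 0, so ρ(w) is defined by the kernel formula). -/

import Mathlib

open scoped BigOperators

noncomputable section

namespace DFTWeil

open scoped Classical

/-- Multiplication of the Heisenberg group `H = (V × V) × Z`,
`(v,z)·(v',z') = (v+v', z+z'+2⁻¹ ω(v,v'))` with `ω((t,w),(t',w')) = t w' - w t'`. -/
def hMul {p : ℕ} (a b : (ZMod p × ZMod p) × ZMod p) : (ZMod p × ZMod p) × ZMod p :=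
  (a.1 + b.1, a.2 + b.2 + (2 : ZMod p)⁻¹ * (a.1.1 * b.1.2 - a.1.2 * b.1.1))

/-- The additive character `ψ(z) = exp(2πi z/p)`. -/
def psi (p : ℕ) (z : ZMod p) : ℂ :=
  Complex.exp (2 * Real.pi * Complex.I * (z.val : ℂ) / p)

/-- The standard realization of the Heisenberg representation:
`(π((t,w),z) f)(x) = ψ(z + 2⁻¹ t w + w x) f(x+t)`. -/
def heis (p : ℕ) (h : (ZMod p × ZMod p) × ZMod p) :
    (ZMod p → ℂ) →ₗ[ℂ] (ZMod p → ℂ) where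
  toFun f x := psi p (h.2 + (2 : ZMod p)⁻¹ * h.1.1 * h.1.2 + h.1.2 * x) * f (x + h.1.1)
  map_add' f g := by funext x; simp [mul_add]
  map_smul' c f := by funext x; simp [Pi.smul_apply, smul_eq_mul]; ring

/-- The Legendre character `σ` of `ZMod p` (extended by `0` at `0`). -/
def sgm (p : ℕ) (a : ZMod p) : ℂ := if a = 0 then 0 else if IsSquare a then 1 else -1

/-- Action of a `2 × 2` matrix on a column vector `v ∈ (ZMod p)²`. -/
def matVec {p : ℕ} (m : Matrix (Fin 2) (Fin 2) (ZMod p)) (v : ZMod p × ZMod p) :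
    ZMod p × ZMod p :=
  (m 0 0 * v.1 + m 0 1 * v.2, m 1 0 * v.1 + m 1 1 * v.2)

/-- The symplectic form `ω((t,w),(t',w')) = t w' - w t'`. -/
def omg {p : ℕ} (v w : ZMod p × ZMod p) : ZMod p := v.1 * w.2 - v.2 * w.1

/-- The Cayley transform `κ(g) = (g+I)(g-I)⁻¹`. -/
def cayley {p : ℕ} (g : Matrix (Fin 2) (Fin 2) (ZMod p)) : Matrix (Fin 2) (Fin 2) (ZMod p) :=
  (g + 1) * (g - 1)⁻¹

/-- The Weil operator given by the kernel formula
`ρ(g) = p⁻¹ σ(-det(κ(g)+I)) Σ_v ψ(4⁻¹ ω(κ(g)v,v)) π(v,0)`. -/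
def weilOp (p : ℕ) [Fact p.Prime] (g : Matrix (Fin 2) (Fin 2) (ZMod p)) :
    (ZMod p → ℂ) →ₗ[ℂ] (ZMod p → ℂ) :=
  (p : ℂ)⁻¹ • sgm p (-((cayley g + 1).det)) •
    ∑ v : ZMod p × ZMod p,
      psi p ((4 : ZMod p)⁻¹ * omg (matVec (cayley g) v) v) • heis p (v, 0)

/-- The discrete Fourier transform `F[f](y) = p^(-1/2) Σ_x ψ(yx) f(x)`. -/
def dft (p : ℕ) [Fact p.Prime] : Module.End ℂ (ZMod p → ℂ) where
  toFun f y := ((Real.sqrt p : ℂ))⁻¹ * ∑ x : ZMod p, psi p (y * x) * f x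
  map_add' f g := by funext y; simp [mul_add, Finset.sum_add_distrib]
  map_smul' c f := by
    funext y
    simp [Pi.smul_apply, smul_eq_mul, Finset.mul_sum]
    ring_nf
    congr 1
    ext x
    ring

open Filter Topology in
lemma tendsto_tsum_cexp_quadratic (N : ℕ) [NeZero N] (b : ℂ) (hb : b.re = 0) :
    Tendsto (fun u : ℂ => ∑' n : ℤ, Complex.exp (-Real.pi * (u / N ^ 2) * n ^ 2
      + 2 * Real.pi * b * n)) (comap Complex.re atTop) (𝓝 1) := by
  have hN : (0 : ℝ) < (N : ℝ) ^ 2 := by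
    have : (0 : ℝ) < N := by exact_mod_cast Nat.pos_of_ne_zero (NeZero.ne N)
    positivity
  have hre (u : ℂ) (n : ℤ) : ‖Complex.exp (-Real.pi * (u / N ^ 2) * n ^ 2
      + 2 * Real.pi * b * n)‖ = Real.exp (u.re * (-Real.pi / N ^ 2 * n ^ 2)) := by
    rw [Complex.norm_exp]
    congr 1
    have h1 : (-Real.pi * (u / N ^ 2) * n ^ 2 + 2 * Real.pi * b * n : ℂ)
        = ((-Real.pi / N ^ 2 * n ^ 2 : ℝ) : ℂ) * u + ((2 * Real.pi * n : ℝ) : ℂ) * b := by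
      push_cast
      ring
    rw [h1, Complex.add_re, Complex.re_ofReal_mul, Complex.re_ofReal_mul, hb]
    ring
  have hsum : Summable fun n : ℤ => Real.exp (-Real.pi / N ^ 2 * n ^ 2) := by
    refine (summable_pow_mul_jacobiTheta₂_term_bound 0 (inv_pos.2 hN) 0).congr fun n => ?_
    rw [pow_zero, one_mul]
    congr 1
    ring
  rw [← tsum_ite_eq (0 : ℤ) (fun _ => (1 : ℂ))]
  refine tendsto_tsum_of_dominated_convergence hsum (fun n => ?_) ?_
  · by_cases hn : n = 0
    · simpa [hn] using tendsto_const_nhds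
    · simp only [hn, if_false]
      rw [tendsto_zero_iff_norm_tendsto_zero]
      simp only [hre]
      have hneg : -Real.pi / (N : ℝ) ^ 2 * (n : ℝ) ^ 2 < 0 := by
        have : (n : ℝ) ≠ 0 := by exact_mod_cast hn
        have h2 : 0 < (n : ℝ) ^ 2 := by positivity
        exact mul_neg_of_neg_of_pos (div_neg_of_neg_of_pos (neg_neg_of_pos Real.pi_pos) hN) h2
      exact Real.tendsto_exp_atBot.comp (tendsto_comap.atTop_mul_const_of_neg hneg)
  · filter_upwards [tendsto_comap.eventually (eventually_ge_atTop (1 : ℝ))] with u hu n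
    rw [hre, Real.exp_le_exp]
    have h0 : -Real.pi / (N : ℝ) ^ 2 * (n : ℝ) ^ 2 ≤ 0 := by
      have := Real.pi_pos
      rw [neg_div, neg_mul]
      exact neg_nonpos.2 (by positivity)
    nlinarith

lemma tsum_cexp_residue (N : ℕ) [NeZero N] (r : ℂ) {u : ℂ} (hu : 0 < u.re) :
    ∑' m : ℤ, Complex.exp (-Real.pi / u * (m * N + r) ^ 2) =
      (u / N ^ 2) ^ (1 / 2 : ℂ) * ∑' n : ℤ, Complex.exp (-Real.pi * (u / N ^ 2) * n ^ 2
        + 2 * Real.pi * (-Complex.I * r / N) * n) := by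
  have hN : (N : ℂ) ≠ 0 := by exact_mod_cast NeZero.ne N
  have hu0 : u ≠ 0 := by
    rintro rfl
    simp at hu
  have ha : 0 < (u / N ^ 2 : ℂ).re := by
    have h1 : (u / N ^ 2 : ℂ) = ((((N : ℝ) ^ 2)⁻¹ : ℝ) : ℂ) * u := by
      push_cast
      ring
    have : (0 : ℝ) < N := by exact_mod_cast Nat.pos_of_ne_zero (NeZero.ne N)
    rw [h1, Complex.re_ofReal_mul]
    positivity
  have hc : (u / N ^ 2 : ℂ) ^ (1 / 2 : ℂ) ≠ 0 := by
    rw [Complex.cpow_ne_zero_iff]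
    exact Or.inl (div_ne_zero hu0 (pow_ne_zero 2 hN))
  rw [Complex.tsum_exp_neg_quadratic ha, ← mul_assoc, mul_one_div, div_self hc, one_mul]
  refine tsum_congr fun m => ?_
  congr 1
  field_simp
  ring_nf
  simp only [Complex.I_sq, Complex.I_pow_four]
  ring

lemma summable_cexp_neg_div_mul_sq {u : ℂ} (hu : 0 < u.re) :
    Summable fun n : ℤ => Complex.exp (-Real.pi / u * n ^ 2) := by
  have hτ : 0 < (Complex.I / u).im := by
    rw [div_eq_mul_inv, Complex.I_mul_im, Complex.inv_re]
    exact div_pos hu (Complex.normSq_pos.2 (by rintro rfl; simp at hu))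
  refine ((summable_jacobiTheta₂_term_iff 0 _).2 hτ).congr fun n => ?_
  rw [jacobiTheta₂_term]
  congr 1
  linear_combination (Real.pi * n ^ 2 / u : ℂ) * Complex.I_sq

open Filter Topology in
/-- The mean of a periodic sequence is recovered from its Gaussian averages. -/
lemma tendsto_periodic_gaussian_mean (N : ℕ) [NeZero N] (c : ℤ → ℂ)
    (hc : ∀ q r : ℤ, c (q * N + r) = c r) (hb : ∃ C, ∀ n, ‖c n‖ ≤ C) :
    Tendsto (fun u : ℂ => (∑' n : ℤ, c n * Complex.exp (-Real.pi / u * n ^ 2)) /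
      (u / N ^ 2) ^ (1 / 2 : ℂ)) (comap Complex.re atTop) (𝓝 (∑ r : Fin N, c (r : ℕ))) := by
  have hN : (N : ℂ) ≠ 0 := by exact_mod_cast NeZero.ne N
  obtain ⟨C, hC⟩ := hb
  have key : Tendsto (fun u : ℂ => ∑ r : Fin N, c (r : ℕ) * ∑' n : ℤ, Complex.exp
      (-Real.pi * (u / N ^ 2) * n ^ 2 + 2 * Real.pi * (-Complex.I * (r : ℕ) / N) * n))
      (comap Complex.re atTop) (𝓝 (∑ r : Fin N, c (r : ℕ))) := by
    refine tendsto_finsetSum _ fun r _ => ?_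
    have := (tendsto_tsum_cexp_quadratic N (-Complex.I * (r : ℕ) / N) (by
      have h1 : (-Complex.I * (r : ℕ) / N : ℂ) = (((-(r : ℕ) / N : ℝ)) : ℂ) * Complex.I := by
        push_cast
        ring
      rw [h1, Complex.re_ofReal_mul, Complex.I_re, mul_zero])).const_mul (c (r : ℕ))
    simpa using this
  refine key.congr' ?_
  filter_upwards [tendsto_comap.eventually (eventually_gt_atTop (0 : ℝ))] with u hu
  have hu0 : u ≠ 0 := by
    rintro rfl
    simp at hu
  have hne : (u / N ^ 2 : ℂ) ^ (1 / 2 : ℂ) ≠ 0 := by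
    rw [Complex.cpow_ne_zero_iff]
    exact Or.inl (div_ne_zero hu0 (pow_ne_zero 2 hN))
  have hs : Summable fun n : ℤ => c n * Complex.exp (-Real.pi / u * n ^ 2) := by
    refine ((summable_cexp_neg_div_mul_sq hu).norm.mul_left C).of_norm_bounded fun n => ?_
    rw [norm_mul]
    exact mul_le_mul_of_nonneg_right (hC n) (norm_nonneg _)
  rw [eq_div_iff hne, ← (Int.divModEquiv N).symm.tsum_eq, ← (Equiv.prodComm _ _).tsum_eq,
    Summable.tsum_prod, tsum_fintype, Finset.sum_mul]
  · refine Finset.sum_congr rfl fun r _ => ?_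
    have h := tsum_cexp_residue N (r : ℕ) hu
    simp only [Equiv.prodComm_apply, Prod.swap_prod_mk, Int.divModEquiv_symm_apply, hc]
    rw [tsum_mul_left, mul_assoc, mul_comm _ ((u / N ^ 2 : ℂ) ^ (1 / 2 : ℂ)), ← h]
    push_cast
    rfl
  · exact (Equiv.prodComm _ _).summable_iff.2 ((Int.divModEquiv N).symm.summable_iff.2 hs)

lemma psi_eq_stdAddChar (p : ℕ) [NeZero p] (z : ZMod p) : psi p z = ZMod.stdAddChar z := by
  have h := ZMod.stdAddChar_coe (N := p) (z.val : ℤ)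
  rw [Int.cast_natCast, ZMod.natCast_zmod_val] at h
  rw [h, psi, Int.cast_natCast]

lemma psi_intCast (p : ℕ) [NeZero p] (n : ℤ) :
    psi p n = Complex.exp (2 * Real.pi * Complex.I * n / p) := by
  rw [psi_eq_stdAddChar, ZMod.stdAddChar_coe]

lemma psi_add (p : ℕ) [NeZero p] (a b : ZMod p) : psi p (a + b) = psi p a * psi p b := by
  simp only [psi_eq_stdAddChar, AddChar.map_add_eq_mul]

lemma norm_psi (p : ℕ) [NeZero p] (z : ZMod p) : ‖psi p z‖ = 1 := by
  rw [psi_eq_stdAddChar, ZMod.stdAddChar_apply, Circle.norm_coe]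

lemma sum_fin_natCast {M : Type*} [AddCommMonoid M] (N : ℕ) [NeZero N] (f : ZMod N → M) :
    ∑ r : Fin N, f ((r : ℕ) : ZMod N) = ∑ z, f z := by
  obtain _ | n := N
  · exact absurd rfl (NeZero.ne 0)
  · exact Finset.sum_congr rfl fun r _ => congrArg f (Fin.cast_val_eq_self r)

lemma cexp_pi_mul_I_div_two_sq (p : ℕ) (q r : ℤ) :
    Complex.exp (Real.pi * Complex.I * p / 2 * ((q * (2 : ℕ) + r : ℤ) : ℂ) ^ 2) =
      Complex.exp (Real.pi * Complex.I * p / 2 * (r : ℂ) ^ 2) := by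
  rw [Complex.exp_eq_exp_iff_exists_int]
  refine ⟨p * (q ^ 2 + q * r), ?_⟩
  push_cast
  ring

lemma ofReal_mul_cpow {x : ℝ} (hx : 0 < x) {z : ℂ} (hz : z ≠ 0) (s : ℂ) :
    ((x : ℂ) * z) ^ s = (x : ℂ) ^ s * z ^ s := by
  have hx' : (x : ℂ) ≠ 0 := by exact_mod_cast hx.ne'
  rw [Complex.cpow_def_of_ne_zero (mul_ne_zero hx' hz), Complex.log_ofReal_mul hx hz,
    Complex.ofReal_log hx.le, add_mul, Complex.exp_add, Complex.cpow_def_of_ne_zero hx',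
    Complex.cpow_def_of_ne_zero hz]

open Filter Topology in
/-- The quadratic Gauss sum, including its sign. -/
lemma sum_psi_neg_sq (p : ℕ) [NeZero p] :
    (1 + Complex.I) * ∑ z : ZMod p, psi p (-z ^ 2) = Real.sqrt p * (1 + Complex.I ^ p) := by
  have hp : (p : ℂ) ≠ 0 := by exact_mod_cast NeZero.ne p
  have hp0 : (0 : ℝ) < p := by exact_mod_cast Nat.pos_of_ne_zero (NeZero.ne p)
  set u : ℝ → ℂ := fun x => x with hu
  set a : ℝ → ℂ := fun x => (1 / x : ℝ) + 2 * Complex.I / p with ha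
  set v : ℝ → ℂ := fun x => ((4 / p ^ 2 * x : ℝ) : ℂ) + ((-2 / p : ℝ) : ℂ) * Complex.I with hv
  have hut : Tendsto u atTop (comap Complex.re atTop) := by
    rw [tendsto_comap_iff]
    exact tendsto_id.congr fun x => (Complex.ofReal_re x).symm
  have hvt : Tendsto v atTop (comap Complex.re atTop) := by
    rw [tendsto_comap_iff]
    have : Complex.re ∘ v = fun x : ℝ => 4 / (p : ℝ) ^ 2 * x := by
      funext x
      simp only [hv, Function.comp, Complex.add_re, Complex.re_ofReal_mul, Complex.ofReal_re,
        Complex.I_re, mul_zero, add_zero]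
    rw [this]
    exact tendsto_id.const_mul_atTop (by positivity)
  have hat : Tendsto a atTop (𝓝 (2 * Complex.I / p)) := by
    have h := (Complex.continuous_ofReal.tendsto 0).comp
      (tendsto_inv_atTop_zero (𝕜 := ℝ))
    have h2 := h.add_const (2 * Complex.I / p : ℂ)
    simpa [ha, Function.comp_def] using h2
  have hL := (tendsto_periodic_gaussian_mean p (fun n => psi p (-(n : ZMod p) ^ 2))
    (fun q r => by simp) ⟨1, fun n => (norm_psi p _).le⟩).comp hut
  have hR := (tendsto_periodic_gaussian_mean 2
    (fun n => Complex.exp (Real.pi * Complex.I * p / 2 * (n : ℂ) ^ 2))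
    (cexp_pi_mul_I_div_two_sq p) ⟨1, fun n => by
      have : (Real.pi * Complex.I * p / 2 * (n : ℂ) ^ 2 : ℂ)
          = ((Real.pi * p / 2 * n ^ 2 : ℝ) : ℂ) * Complex.I := by
        push_cast
        ring
      rw [this, Complex.norm_exp_ofReal_mul_I]⟩).comp hvt
  have hroot : (2 * Complex.I / p : ℂ) ^ (1 / 2 : ℂ) = (1 + Complex.I) / Real.sqrt p := by
    have hs : ((Real.sqrt p : ℝ) : ℂ) ^ 2 = p := by
      rw [← Complex.ofReal_pow, Real.sq_sqrt hp0.le, Complex.ofReal_natCast]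
    have h1 : (2 * Complex.I / p : ℂ) = ((1 + Complex.I) / Real.sqrt p) ^ 2 := by
      rw [div_pow, hs]
      congr 1
      linear_combination -Complex.I_sq
    rw [h1, one_div, Complex.sq_cpow_two_inv]
    rw [Complex.div_ofReal_re]
    simpa using hp0
  have hslit : (2 * Complex.I / p : ℂ) ∈ Complex.slitPlane := by
    right
    have : (2 * Complex.I / p : ℂ) = ((2 / p : ℝ) : ℂ) * Complex.I := by
      push_cast
      ring
    rw [this, Complex.im_ofReal_mul, Complex.I_im]
    positivity
  have hz : Tendsto (fun x => (a x / (2 * Complex.I * p)) ^ (1 / 2 : ℂ)) atTop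
      (𝓝 ((1 / p : ℝ) : ℂ)) := by
    have h1 : (2 * Complex.I / p / (2 * Complex.I * p) : ℂ) = (((1 / p : ℝ) : ℂ)) ^ 2 := by
      push_cast
      field_simp
    have h2 : (((1 / p : ℝ) : ℂ) ^ 2) ^ (1 / 2 : ℂ) = ((1 / p : ℝ) : ℂ) := by
      rw [one_div (2 : ℂ), Complex.sq_cpow_two_inv]
      rw [Complex.ofReal_re]
      positivity
    have h3 := hat.div_const (2 * Complex.I * p)
    rw [h1] at h3
    have h4 : ((1 / p : ℝ) : ℂ) ^ 2 ∈ Complex.slitPlane := by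
      rw [← Complex.ofReal_pow]
      exact Complex.ofReal_mem_slitPlane.2 (by positivity)
    have h5 := ((continuousAt_cpow_const (b := (1 / 2 : ℂ)) h4).tendsto.comp h3)
    rwa [h2] at h5
  have hsum2 : ∑ r : Fin 2, Complex.exp (Real.pi * Complex.I * p / 2 * (((r : ℕ) : ℤ) : ℂ) ^ 2)
      = 1 + Complex.I ^ p := by
    rw [Fin.sum_univ_two]
    congr 1
    · simp
    · have : (Real.pi * Complex.I * p / 2 * (((((1 : Fin 2) : ℕ) : ℤ)) : ℂ) ^ 2 : ℂ)
          = p * (Real.pi / 2 * Complex.I) := by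
        simp
        ring
      rw [this, Complex.exp_nat_mul, Complex.exp_pi_div_two_mul_I]
  have hsum1 : ∑ r : Fin p, psi p (-(((r : ℕ) : ℤ) : ZMod p) ^ 2)
      = ∑ z : ZMod p, psi p (-z ^ 2) := by
    rw [← sum_fin_natCast p (fun z => psi p (-z ^ 2))]
    simp
  rw [hsum1] at hL
  rw [hsum2] at hR
  have hA := (continuousAt_cpow_const (b := (1 / 2 : ℂ)) hslit).tendsto.comp hat
  rw [hroot] at hA
  have hlim := (hA.mul hL).mul_const ((1 / p : ℝ) : ℂ)
  have hlim2 := hR.mul hz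
  have heq := tendsto_nhds_unique (hlim.congr' ?_) hlim2
  · have hs0 : ((Real.sqrt p : ℝ) : ℂ) ≠ 0 := by
      exact_mod_cast (Real.sqrt_pos.2 hp0).ne'
    push_cast at heq
    field_simp at heq
    linear_combination heq
  · filter_upwards [eventually_gt_atTop (0 : ℝ)] with x hx
    have hxc : (x : ℂ) ≠ 0 := by exact_mod_cast hx.ne'
    have hare : 0 < (a x).re := by
      have : a x = ((1 / x : ℝ) : ℂ) + ((2 / p : ℝ) : ℂ) * Complex.I := by
        simp only [ha]
        push_cast
        ring
      rw [this, Complex.add_re, Complex.ofReal_re, Complex.re_ofReal_mul, Complex.I_re, mul_zero,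
        add_zero]
      positivity
    have ha0 : a x ≠ 0 := by
      intro h
      simp [h] at hare
    have hac : a x ^ (1 / 2 : ℂ) ≠ 0 := by
      rw [Complex.cpow_ne_zero_iff]
      exact Or.inl ha0
    have hva : v x = 4 * (x * (a x / (2 * Complex.I * p))) := by
      simp only [ha, hv]
      push_cast
      field_simp
      linear_combination (-4 * p : ℂ) * Complex.I_sq
    have e1 : ∑' n : ℤ, psi p (-(n : ZMod p) ^ 2) * Complex.exp (-Real.pi / u x * n ^ 2)
        = ∑' n : ℤ, Complex.exp (-Real.pi * a x * n ^ 2) := by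
      refine tsum_congr fun n => ?_
      have : (-(n : ZMod p) ^ 2) = ((-n ^ 2 : ℤ) : ZMod p) := by push_cast; rfl
      rw [this, psi_intCast, ← Complex.exp_add]
      congr 1
      simp only [ha, hu]
      push_cast
      ring
    have e2 : ∑' n : ℤ, Complex.exp (Real.pi * Complex.I * p / 2 * (n : ℂ) ^ 2)
        * Complex.exp (-Real.pi / v x * n ^ 2)
        = ∑' n : ℤ, Complex.exp (-Real.pi / a x * n ^ 2) := by
      refine tsum_congr fun n => ?_
      rw [← Complex.exp_add]
      congr 1
      have h3 : Complex.I * p / 2 - 1 / v x = -1 / a x := by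
        rw [hva]
        field_simp
        simp only [ha]
        push_cast
        field_simp
        linear_combination (8 * x : ℂ) * Complex.I_sq
      linear_combination (Real.pi * n ^ 2 : ℂ) * h3
    have e3 : (u x / p ^ 2) ^ (1 / 2 : ℂ) = (x : ℂ) ^ (1 / 2 : ℂ) * ((1 / p : ℝ) : ℂ) := by
      have : (u x / p ^ 2 : ℂ) = (x : ℂ) * (((1 / p : ℝ) ^ 2 : ℝ) : ℂ) := by
        simp only [hu]
        push_cast
        field_simp
      rw [this, Complex.mul_cpow_ofReal_nonneg hx.le (by positivity)]
      congr 1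
      rw [Complex.ofReal_pow, one_div (2 : ℂ), Complex.sq_cpow_two_inv]
      rw [Complex.ofReal_re]
      positivity
    have e4 : (v x / (2 : ℕ) ^ 2) ^ (1 / 2 : ℂ)
        = (x : ℂ) ^ (1 / 2 : ℂ) * (a x / (2 * Complex.I * p)) ^ (1 / 2 : ℂ) := by
      have : v x / (2 : ℕ) ^ 2 = x * (a x / (2 * Complex.I * p)) := by
        rw [hva]
        push_cast
        ring
      rw [this, ofReal_mul_cpow hx (div_ne_zero ha0 (by simp [hp]))]
    have hxr : (x : ℂ) ^ (1 / 2 : ℂ) ≠ 0 := by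
      rw [Complex.cpow_ne_zero_iff]
      exact Or.inl hxc
    have hbr : (a x / (2 * Complex.I * p)) ^ (1 / 2 : ℂ) ≠ 0 := by
      rw [Complex.cpow_ne_zero_iff]
      exact Or.inl (div_ne_zero ha0 (by simp [hp]))
    simp only [Function.comp]
    rw [e1, e2, e3, e4, Complex.tsum_exp_neg_mul_int_sq hare]
    have hpr : ((1 / p : ℝ) : ℂ) ≠ 0 := by
      exact_mod_cast (by positivity : (1 / p : ℝ) ≠ 0)
    generalize ((1 / p : ℝ) : ℂ) = y at hpr ⊢
    field_simp

lemma two_ne_zero_of_odd_prime (p : ℕ) [Fact p.Prime] (hp : p ≠ 2) : (2 : ZMod p) ≠ 0 :=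
  Ring.two_ne_zero (by rwa [ZMod.ringChar_zmod_n])

lemma cayley_weyl (p : ℕ) [Fact p.Prime] (hp : p ≠ 2) :
    cayley (!![0, 1; -1, 0] : Matrix (Fin 2) (Fin 2) (ZMod p)) = !![0, -1; 1, 0] := by
  have h2 := two_ne_zero_of_odd_prime p hp
  have hinv : (!![0, 1; -1, 0] - 1 : Matrix (Fin 2) (Fin 2) (ZMod p))⁻¹
      = (2 : ZMod p)⁻¹ • !![-1, -1; 1, -1] := by
    refine Matrix.inv_eq_right_inv ?_
    ext i j
    fin_cases i <;> fin_cases j <;>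
      simp [Matrix.mul_apply, Fin.sum_univ_two] <;> field_simp <;> ring
  rw [cayley, hinv]
  ext i j
  fin_cases i <;> fin_cases j <;>
    simp [Matrix.mul_apply, Fin.sum_univ_two] <;> field_simp <;> ring

lemma sum_psi_weyl_kernel (p : ℕ) [Fact p.Prime] (hp : p ≠ 2) (y t : ZMod p) :
    ∑ w : ZMod p, psi p ((4 : ZMod p)⁻¹ * (-w * w - t * t)) *
      psi p (0 + (2 : ZMod p)⁻¹ * t * w + w * y) =
      psi p (y * (y + t)) * ∑ z : ZMod p, psi p (-z ^ 2) := by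
  have h2 := two_ne_zero_of_odd_prime p hp
  have h4 : (4 : ZMod p) ≠ 0 := by
    have : (4 : ZMod p) = 2 * 2 := by norm_num
    rw [this]
    exact mul_ne_zero h2 h2
  rw [← ((Equiv.mulLeft₀ (2 : ZMod p) h2).trans (Equiv.addLeft (t + 2 * y))).sum_comp,
    Finset.mul_sum]
  refine Finset.sum_congr rfl fun z _ => ?_
  rw [← psi_add, ← psi_add]
  congr 1
  change 4⁻¹ * (-(t + 2 * y + 2 * z) * (t + 2 * y + 2 * z) - t * t) +
    (0 + 2⁻¹ * t * (t + 2 * y + 2 * z) + (t + 2 * y + 2 * z) * y) = y * (y + t) + -z ^ 2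
  have h5 : (2 : ZMod p)⁻¹ = 2 * 4⁻¹ := by
    rw [eq_mul_inv_iff_mul_eq₀ h4]
    field_simp
    norm_num
  rw [h5]
  refine mul_left_cancel₀ h4 ?_
  linear_combination ((t + 2 * y + 2 * z) * t * 2
    - (t + 2 * y + 2 * z) ^ 2 - t * t) * mul_inv_cancel₀ h4

lemma I_pow_mul_sgm_neg_two (p : ℕ) [Fact p.Prime] (hp : p ≠ 2) :
    Complex.I ^ ((p - 1) / 2) * sgm p (-2) * (1 + Complex.I ^ p) = 1 + Complex.I := by
  have h2 : (-2 : ZMod p) ≠ 0 := neg_ne_zero.2 (two_ne_zero_of_odd_prime p hp)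
  have hodd := (Fact.out : p.Prime).eq_two_or_odd.resolve_left hp
  rw [sgm, if_neg h2, ZMod.exists_sq_eq_neg_two_iff hp]
  obtain ⟨q, r, hr, rfl⟩ : ∃ q r, r < 8 ∧ p = 8 * q + r :=
    ⟨p / 8, p % 8, Nat.mod_lt _ (by norm_num), (Nat.div_add_mod p 8).symm⟩
  have hI4 (m r : ℕ) : Complex.I ^ (4 * m + r) = Complex.I ^ r := by
    rw [pow_add, pow_mul, Complex.I_pow_four, one_pow, one_mul]
  have hmod : (8 * q + r) % 8 = r := by lia
  have e1 : (8 * q + r - 1) / 2 = 4 * q + (r - 1) / 2 := by lia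
  have e2 : 8 * q + r = 4 * (2 * q) + r := by lia
  rw [hmod, e1, hI4]
  conv_lhs => rw [e2, hI4]
  have hr2 : r % 2 = 1 := by lia
  clear hmod e1 e2 hodd
  interval_cases r <;> simp_all [Complex.I_pow_three]
  all_goals linear_combination -Complex.I_sq

/-- The DFT equals `i^((p-1)/2)` times the Weil operator at the Weyl element. -/
theorem stmt8 (p : ℕ) [Fact p.Prime] (hp : p ≠ 2) :
    (dft p : (ZMod p → ℂ) →ₗ[ℂ] (ZMod p → ℂ)) =
      (Complex.I ^ ((p - 1) / 2)) • weilOp p !![0, 1; -1, 0] := by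
  have hp0 : (0 : ℝ) < p := by exact_mod_cast (Fact.out : p.Prime).pos
  have hs : ((Real.sqrt p : ℝ) : ℂ) ^ 2 = p := by
    rw [← Complex.ofReal_pow, Real.sq_sqrt hp0.le, Complex.ofReal_natCast]
  have hs0 : ((Real.sqrt p : ℝ) : ℂ) ≠ 0 := by exact_mod_cast (Real.sqrt_pos.2 hp0).ne'
  have hdet : -((cayley (!![0, 1; -1, 0] : Matrix (Fin 2) (Fin 2) (ZMod p)) + 1).det) = -2 := by
    rw [cayley_weyl p hp, Matrix.det_fin_two]
    simp
    norm_num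
  refine LinearMap.ext fun f => funext fun y => ?_
  have hweil : ∑ v : ZMod p × ZMod p,
      psi p ((4 : ZMod p)⁻¹ * omg (matVec (cayley !![0, 1; -1, 0]) v) v) *
        heis p (v, 0) f y = (∑ z : ZMod p, psi p (-z ^ 2)) * ∑ x, psi p (y * x) * f x := by
    rw [cayley_weyl p hp, Fintype.sum_prod_type, 
      ← Equiv.sum_comp (Equiv.addLeft y) (fun x => psi p (y * x) * f x), Finset.mul_sum]
    refine Finset.sum_congr rfl fun t _ => ?_
    rw [Equiv.coe_addLeft, ← mul_assoc, mul_comm (∑ z : ZMod p, psi p (-z ^ 2)),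
      ← sum_psi_weyl_kernel p hp, Finset.sum_mul]
    refine Finset.sum_congr rfl fun w _ => ?_
    simp [omg, matVec, heis, mul_assoc]
  have hscalar : Complex.I ^ ((p - 1) / 2) * ((p : ℂ)⁻¹ * (sgm p (-2) *
      ∑ z : ZMod p, psi p (-z ^ 2))) = ((Real.sqrt p : ℝ) : ℂ)⁻¹ := by
    have h1 : (1 + Complex.I : ℂ) ≠ 0 := fun h => by simpa using congrArg Complex.re h
    have h2 : Complex.I ^ ((p - 1) / 2) * sgm p (-2) * ∑ z : ZMod p, psi p (-z ^ 2) =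
        Real.sqrt p := by
      refine mul_left_cancel₀ h1 ?_
      linear_combination Complex.I ^ ((p - 1) / 2) * sgm p (-2) * sum_psi_neg_sq p
        + (Real.sqrt p : ℂ) * I_pow_mul_sgm_neg_two p hp
    rw [← hs]
    field_simp
    linear_combination h2
  simp only [weilOp, hdet, LinearMap.smul_apply, LinearMap.sum_apply, Pi.smul_apply,
    Finset.sum_apply, smul_eq_mul, hweil]
  change ((Real.sqrt p : ℝ) : ℂ)⁻¹ * ∑ x, psi p (y * x) * f x = _
  rw [← hscalar]
  ring

end DFTWeil
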